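/- Let u ∈ S_n and let x be an invertible n×n real matrix such that both x and x u⁻¹ admit Gaussian decompositions. Then u⁻¹ [x u⁻¹]_+ u admits a Gaussian decomposition, and u · [u⁻¹ [x u⁻¹]_+ u]_- admits a Gaussian decomposition. -/

import Mathlib

open scoped Classical

namespace BruhatTNN

abbrev Mat (n : ℕ) := Matrix (Fin n) (Fin n) ℝ

/-- `x` is upper unitriangular. -/
def upperUni {n : ℕ} (x : Mat n) : Prop :=
  (∀ i, x i i = 1) ∧ ∀ i j : Fin n, j < i → x i j = 0

/-- `x` is lower unitriangular. -/
def lowerUni {n : ℕ} (x : Mat n) : Prop :=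
  (∀ i, x i i = 1) ∧ ∀ i j : Fin n, i < j → x i j = 0

/-- `x` is invertible upper triangular (`x ∈ B`). -/
def upperTriInv {n : ℕ} (x : Mat n) : Prop :=
  IsUnit x.det ∧ ∀ i j : Fin n, j < i → x i j = 0

/-- `x` is invertible lower triangular (`x ∈ B_-`). -/
def lowerTriInv {n : ℕ} (x : Mat n) : Prop :=
  IsUnit x.det ∧ ∀ i j : Fin n, i < j → x i j = 0

/-- `x` is invertible diagonal (`x ∈ H`). -/
def diagInv {n : ℕ} (x : Mat n) : Prop :=
  IsUnit x.det ∧ ∀ i j : Fin n, i ≠ j → x i j = 0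

/-- `x` admits a Gaussian decomposition (`x ∈ G_0`). -/
def hasGauss {n : ℕ} (x : Mat n) : Prop :=
  ∃ a d b : Mat n, lowerUni a ∧ diagInv d ∧ upperUni b ∧ x = a * d * b

/-- The factor `[x]_-` of the Gaussian decomposition (junk value `1` if none exists). -/
noncomputable def gaussMinus {n : ℕ} (x : Mat n) : Mat n :=
  if h : hasGauss x then h.choose else 1

/-- The factor `[x]_0` of the Gaussian decomposition (junk value `1` if none exists). -/
noncomputable def gaussDiag {n : ℕ} (x : Mat n) : Mat n :=
  if h : hasGauss x then h.choose_spec.choose else 1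

/-- The factor `[x]_+` of the Gaussian decomposition (junk value `1` if none exists). -/
noncomputable def gaussPlus {n : ℕ} (x : Mat n) : Mat n :=
  if h : hasGauss x then h.choose_spec.choose_spec.choose else 1

/-- The permutation matrix of `w`, with entry `1` in position `(w j, j)`. -/
def permMat {n : ℕ} (w : Equiv.Perm (Fin n)) : Mat n :=
  Matrix.of fun i j => if i = w j then (1 : ℝ) else 0

/-- The minor of `x` with row set `I` and column set `J` (taken in increasing order). -/
def minorOf {n : ℕ} (x : Mat n) (k : ℕ) (I J : Finset (Fin n))
    (hI : I.card = k) (hJ : J.card = k) : ℝ :=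
  Matrix.det (Matrix.of fun a b : Fin k => x (I.orderEmbOfFin hI a) (J.orderEmbOfFin hJ b))

/-- `x` is totally nonnegative: all its minors are nonnegative. -/
def totNonneg {n : ℕ} (x : Mat n) : Prop :=
  ∀ (k : ℕ) (I J : Finset (Fin n)) (hI : I.card = k) (hJ : J.card = k),
    0 ≤ minorOf x k I J hI hJ

/-- The Bruhat order on the symmetric group. -/
def bruhatLE {n : ℕ} (u v : Equiv.Perm (Fin n)) : Prop :=
  ∀ i j : Fin n,
    (Finset.univ.filter fun k : Fin n => k ≤ i ∧ j ≤ u k).card ≤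
    (Finset.univ.filter fun k : Fin n => k ≤ i ∧ j ≤ v k).card

/-- The double coset `B_- w B_-`. -/
def doubleCosetBm {n : ℕ} (w : Equiv.Perm (Fin n)) : Set (Mat n) :=
  {x | ∃ b₁ b₂ : Mat n, lowerTriInv b₁ ∧ lowerTriInv b₂ ∧ x = b₁ * permMat w * b₂}

/-- `N^w = B_- w B_- ∩ N`. -/
def Ncell {n : ℕ} (w : Equiv.Perm (Fin n)) : Set (Mat n) :=
  {x | upperUni x ∧ x ∈ doubleCosetBm w}

/-- `N_-(w) = w⁻¹ N w ∩ N_-`. -/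
def Nminus {n : ℕ} (w : Equiv.Perm (Fin n)) : Set (Mat n) :=
  {x | lowerUni x ∧ ∃ y : Mat n, upperUni y ∧ x = permMat w⁻¹ * y * permMat w}

/-- `N(w) = w⁻¹ N w ∩ N`. -/
def Ngrp {n : ℕ} (w : Equiv.Perm (Fin n)) : Set (Mat n) :=
  {x | upperUni x ∧ ∃ y : Mat n, upperUni y ∧ x = permMat w⁻¹ * y * permMat w}

/-- The totally positive cell `Y°_w = Y ∩ B_- w B_-`. -/
def Ycirc {n : ℕ} (w : Equiv.Perm (Fin n)) : Set (Mat n) :=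
  {x | upperUni x ∧ totNonneg x ∧ x ∈ doubleCosetBm w}

/-- `Y_{≥ u} = ⋃_{v ≥ u} Y°_v`. -/
def Yge {n : ℕ} (u : Equiv.Perm (Fin n)) : Set (Mat n) :=
  {x | ∃ v, bruhatLE u v ∧ x ∈ Ycirc v}

/-- `A = u⁻¹ [x u⁻¹]_+ u`. -/
noncomputable def Amat {n : ℕ} (u : Equiv.Perm (Fin n)) (x : Mat n) : Mat n :=
  permMat u⁻¹ * gaussPlus (x * permMat u⁻¹) * permMat u

/-- The projection `π_u(x) = [u [u⁻¹ [x u⁻¹]_+ u]_-]_+`. -/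
noncomputable def piMap {n : ℕ} (u : Equiv.Perm (Fin n)) (x : Mat n) : Mat n :=
  gaussPlus (permMat u * gaussMinus (Amat u x))

/-- `str(M)`: the sum of the matrix entries immediately above the main diagonal. -/
def strAbove {n : ℕ} (M : Mat n) : ℝ :=
  ∑ p : Fin n × Fin n, if (p.1 : ℕ) + 1 = (p.2 : ℕ) then M p.1 p.2 else 0

/-- The number of inversions (the length) of a permutation. -/
def invNum {n : ℕ} (w : Equiv.Perm (Fin n)) : ℕ :=
  (Finset.univ.filter fun p : Fin n × Fin n => p.1 < p.2 ∧ w p.2 < w p.1).card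

theorem upperTriInv_iff {n : ℕ} (x : Mat n) :
    upperTriInv x ↔ IsUnit x.det ∧ x.BlockTriangular id :=
  Iff.rfl

theorem lowerTriInv_iff_transpose {n : ℕ} (x : Mat n) : lowerTriInv x ↔ upperTriInv x.transpose := by
  simp only [lowerTriInv, upperTriInv, Matrix.det_transpose, Matrix.transpose_apply]
  exact and_congr_right fun _ => forall_comm

theorem lowerUni_iff_transpose {n : ℕ} (x : Mat n) : lowerUni x ↔ upperUni x.transpose := by
  simp only [lowerUni, upperUni, Matrix.transpose_apply]
  exact and_congr_right fun _ => forall_comm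

theorem upperTriInv.mul {n : ℕ} {x y : Mat n} (hx : upperTriInv x) (hy : upperTriInv y) :
    upperTriInv (x * y) := by
  rw [upperTriInv_iff] at *
  exact ⟨by rw [Matrix.det_mul]; exact hx.1.mul hy.1, hx.2.mul hy.2⟩

theorem upperTriInv.inv {n : ℕ} {x : Mat n} (hx : upperTriInv x) : upperTriInv x⁻¹ := by
  rw [upperTriInv_iff] at *
  have := x.invertibleOfIsUnitDet hx.1
  exact ⟨Matrix.isUnit_nonsing_inv_det _ hx.1,
    Matrix.blockTriangular_inv_of_blockTriangular hx.2⟩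

theorem lowerTriInv.mul {n : ℕ} {x y : Mat n} (hx : lowerTriInv x) (hy : lowerTriInv y) :
    lowerTriInv (x * y) := by
  rw [lowerTriInv_iff_transpose] at *
  rw [Matrix.transpose_mul]
  exact hy.mul hx

theorem lowerTriInv.inv {n : ℕ} {x : Mat n} (hx : lowerTriInv x) : lowerTriInv x⁻¹ := by
  rw [lowerTriInv_iff_transpose] at *
  rw [Matrix.transpose_nonsing_inv]
  exact hx.inv

theorem upperUni.upperTriInv {n : ℕ} {x : Mat n} (hx : upperUni x) : upperTriInv x := by
  have h : x.BlockTriangular id := hx.2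
  exact ⟨by rw [Matrix.det_of_isUpperTriangular h]; simp [hx.1], hx.2⟩

theorem lowerUni.lowerTriInv {n : ℕ} {x : Mat n} (hx : lowerUni x) : lowerTriInv x :=
  (lowerTriInv_iff_transpose x).2 ((lowerUni_iff_transpose x).1 hx).upperTriInv

theorem diagInv.upperTriInv {n : ℕ} {x : Mat n} (hx : diagInv x) : upperTriInv x :=
  ⟨hx.1, fun _ _ h => hx.2 _ _ h.ne'⟩

theorem diagInv.lowerTriInv {n : ℕ} {x : Mat n} (hx : diagInv x) : lowerTriInv x :=
  ⟨hx.1, fun _ _ h => hx.2 _ _ h.ne⟩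

theorem diagInv_diagonal {n : ℕ} {d : Fin n → ℝ} (hd : ∀ i, d i ≠ 0) :
    diagInv (Matrix.diagonal d) :=
  ⟨by rw [Matrix.det_diagonal]; exact (Finset.prod_ne_zero_iff.2 fun i _ => hd i).isUnit,
    fun _ _ h => Matrix.diagonal_apply_ne _ h⟩

theorem upperTriInv.exists_diagonal_mul {n : ℕ} {x : Mat n} (hx : upperTriInv x) :
    ∃ (d : Fin n → ℝ) (b : Mat n), (∀ i, d i ≠ 0) ∧ upperUni b ∧ x = Matrix.diagonal d * b := by
  have hd : ∀ i, x i i ≠ 0 := by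
    have h : x.BlockTriangular id := hx.2
    have h' := hx.1.ne_zero
    rw [Matrix.det_of_isUpperTriangular h, Finset.prod_ne_zero_iff] at h'
    exact fun i => h' i (Finset.mem_univ i)
  refine ⟨fun i => x i i, Matrix.diagonal (fun i => (x i i)⁻¹) * x, hd, ⟨?_, ?_⟩, ?_⟩
  · intro i
    rw [Matrix.diagonal_mul, inv_mul_cancel₀ (hd i)]
  · intro i j hij
    rw [Matrix.diagonal_mul, hx.2 i j hij, mul_zero]
  · ext i j
    rw [Matrix.diagonal_mul, Matrix.diagonal_mul, mul_inv_cancel_left₀ (hd i)]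

theorem lowerTriInv.exists_mul_diagonal {n : ℕ} {x : Mat n} (hx : lowerTriInv x) :
    ∃ (a : Mat n) (d : Fin n → ℝ), lowerUni a ∧ (∀ i, d i ≠ 0) ∧ x = a * Matrix.diagonal d := by
  obtain ⟨d, b, hd, hb, h⟩ := ((lowerTriInv_iff_transpose x).1 hx).exists_diagonal_mul
  refine ⟨b.transpose, d, (lowerUni_iff_transpose _).2 hb, hd, ?_⟩
  rw [← Matrix.transpose_transpose x, h, Matrix.transpose_mul, Matrix.diagonal_transpose]

theorem hasGauss_of_lowerTriInv_mul_upperTriInv {n : ℕ} {x y : Mat n} (hx : lowerTriInv x)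
    (hy : upperTriInv y) : hasGauss (x * y) := by
  obtain ⟨a, d, ha, hd, rfl⟩ := hx.exists_mul_diagonal
  obtain ⟨e, b, he, hb, rfl⟩ := hy.exists_diagonal_mul
  refine ⟨a, Matrix.diagonal fun i => d i * e i, b, ha,
    diagInv_diagonal fun i => mul_ne_zero (hd i) (he i), hb, ?_⟩
  rw [← Matrix.diagonal_mul_diagonal]
  simp only [Matrix.mul_assoc]

theorem hasGauss.gaussPlus_spec {n : ℕ} {x : Mat n} (h : hasGauss x) :
    upperUni (gaussPlus x) ∧ ∃ l : Mat n, lowerTriInv l ∧ x = l * gaussPlus x := by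
  obtain ⟨ha, hd, hb, hx⟩ := h.choose_spec.choose_spec.choose_spec
  rw [gaussPlus, dif_pos h]
  exact ⟨hb, _, ha.lowerTriInv.mul hd.lowerTriInv, hx⟩

theorem hasGauss.gaussMinus_spec {n : ℕ} {x : Mat n} (h : hasGauss x) :
    lowerUni (gaussMinus x) ∧ ∃ b : Mat n, upperTriInv b ∧ x = gaussMinus x * b := by
  obtain ⟨ha, hd, hb, hx⟩ := h.choose_spec.choose_spec.choose_spec
  rw [gaussMinus, dif_pos h]
  exact ⟨ha, _, hd.upperTriInv.mul hb.upperTriInv, hx.trans (Matrix.mul_assoc _ _ _)⟩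

/-- A matrix that is unitriangular with respect to some ordering of the indices (given by a height
function `f`) is a product of a lower and an upper unitriangular matrix: both properties pass to
the Schur complement of the top left entry. -/
theorem exists_lowerUni_mul_upperUni : ∀ {n : ℕ} (x : Mat n) (f : Fin n → ℕ), (∀ i, x i i = 1) →
    (∀ i j, i ≠ j → f j ≤ f i → x i j = 0) →
    ∃ a b : Mat n, lowerUni a ∧ upperUni b ∧ x = a * b
  | 0, x, _, _, _ => ⟨x, x, ⟨fun i => i.elim0, fun i => i.elim0⟩,
      ⟨fun i => i.elim0, fun i => i.elim0⟩, by ext i; exact i.elim0⟩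
  | n + 1, x, f, hdiag, hf => by
    obtain ⟨a, b, ha, hb, hab⟩ := exists_lowerUni_mul_upperUni
      (Matrix.of fun i j : Fin n => x i.succ j.succ - x i.succ 0 * x 0 j.succ)
      (fun i => f i.succ)
      (by
        intro i
        rcases le_total (f 0) (f i.succ) with h | h
        · simp [hdiag, hf i.succ 0 (Fin.succ_ne_zero i) h]
        · simp [hdiag, hf 0 i.succ (Fin.succ_ne_zero i).symm h])
      (by
        intro i j hij h
        have hx := hf i.succ j.succ (fun e => hij (Fin.succ_injective n e)) h
        rcases le_total (f 0) (f i.succ) with h' | h'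
        · simp [hx, hf i.succ 0 (Fin.succ_ne_zero i) h']
        · simp [hx, hf 0 j.succ (Fin.succ_ne_zero j).symm (h.trans h')])
    refine ⟨Matrix.of (Fin.cons (Fin.cons 1 0) fun i => Fin.cons (x i.succ 0) (a i)),
      Matrix.of (Fin.cons (Fin.cons 1 fun j => x 0 j.succ) fun i => Fin.cons 0 (b i)),
      ⟨?_, ?_⟩, ⟨?_, ?_⟩, ?_⟩
    · intro i
      cases i using Fin.cases <;> simp [ha.1]
    · intro i j hij
      cases i using Fin.cases <;> cases j using Fin.cases <;> simp_all [ha.2]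
    · intro i
      cases i using Fin.cases <;> simp [hb.1]
    · intro i j hij
      cases i using Fin.cases <;> cases j using Fin.cases <;> simp_all [hb.2]
    · ext i j
      cases i using Fin.cases with
      | zero => cases j using Fin.cases <;> simp [Matrix.mul_apply, Fin.sum_univ_succ, hdiag]
      | succ i =>
        cases j using Fin.cases with
        | zero => simp [Matrix.mul_apply, Fin.sum_univ_succ]
        | succ j =>
          have h := congrFun (congrFun hab i) j
          rw [Matrix.of_apply, Matrix.mul_apply] at h
          simp [Matrix.mul_apply, Fin.sum_univ_succ, ← h]

theorem permMat_inv_mul_mul_apply {n : ℕ} (u : Equiv.Perm (Fin n)) (y : Mat n) (i j : Fin n) :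
    (permMat u⁻¹ * y * permMat u) i j = y (u i) (u j) := by
  simp [permMat, Matrix.mul_apply, Equiv.eq_symm_apply]

theorem permMat_mul_permMat_inv {n : ℕ} (u : Equiv.Perm (Fin n)) :
    permMat u * permMat u⁻¹ = 1 := by
  ext i j
  simp [permMat, Matrix.mul_apply, Matrix.one_apply]

theorem hasGauss_permMat_inv_mul_mul {n : ℕ} (u : Equiv.Perm (Fin n)) {y : Mat n}
    (hy : upperUni y) : hasGauss (permMat u⁻¹ * y * permMat u) := by
  obtain ⟨a, b, ha, hb, h⟩ := exists_lowerUni_mul_upperUni (permMat u⁻¹ * y * permMat u)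
    (fun i => u i) (fun i => by rw [permMat_inv_mul_mul_apply, hy.1])
    (fun i j hij h => by
      rw [permMat_inv_mul_mul_apply]
      exact hy.2 _ _ (lt_of_le_of_ne h fun e => hij (u.injective e.symm)))
  rw [h]
  exact hasGauss_of_lowerTriInv_mul_upperTriInv ha.lowerTriInv hb.upperTriInv

theorem statement10 (n : ℕ) (hn : 1 ≤ n) (u : Equiv.Perm (Fin n)) (x : Mat n)
    (hx : IsUnit x.det) (h1 : hasGauss x) (h2 : hasGauss (x * permMat u⁻¹)) :
    hasGauss (permMat u⁻¹ * gaussPlus (x * permMat u⁻¹) * permMat u) ∧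
    hasGauss (permMat u *
      gaussMinus (permMat u⁻¹ * gaussPlus (x * permMat u⁻¹) * permMat u)) := by
  obtain ⟨hy, l, hl, hxl⟩ := h2.gaussPlus_spec
  have hA := hasGauss_permMat_inv_mul_mul u hy
  refine ⟨hA, ?_⟩
  obtain ⟨-, b, hb, hAb⟩ := hA.gaussMinus_spec
  obtain ⟨hz, l', hl', hxl'⟩ := h1.gaussPlus_spec
  generalize gaussPlus (x * permMat u⁻¹) = y at *
  generalize gaussMinus (permMat u⁻¹ * y * permMat u) = m at *
  generalize gaussPlus x = z at *
  have hm : permMat u * m = (l⁻¹ * l') * (z * b⁻¹) := by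
    have hx' : x = l * y * permMat u := by
      rw [← hxl, Matrix.mul_assoc, mul_eq_one_comm.1 (permMat_mul_permMat_inv u), Matrix.mul_one]
    have hyu : l⁻¹ * x = y * permMat u := by
      rw [hx', Matrix.mul_assoc, Matrix.nonsing_inv_mul_cancel_left _ _ hl.1]
    have hmb : permMat u * m * b = y * permMat u := by
      rw [Matrix.mul_assoc, ← hAb, ← Matrix.mul_assoc, ← Matrix.mul_assoc,
        permMat_mul_permMat_inv, Matrix.one_mul]
    calc permMat u * m = permMat u * m * b * b⁻¹ :=
          (Matrix.mul_nonsing_inv_cancel_right _ _ hb.1).symm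
      _ = l⁻¹ * (l' * z) * b⁻¹ := by rw [hmb, ← hyu, ← hxl']
      _ = (l⁻¹ * l') * (z * b⁻¹) := by simp only [Matrix.mul_assoc]
  rw [hm]
  exact hasGauss_of_lowerTriInv_mul_upperTriInv (hl.inv.mul hl') (hz.upperTriInv.mul hb.inv)

end BruhatTNN
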